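/- arXiv:2305.09776 — 5 statements merged into one kernel-verified Lean document; each statement's English description precedes it below -/
import Mathlib

section
/- Let M₁ < M₂, [α,β] ⊆ [M₁,M₂], and let A, B : L_p([M₁,M₂]) → L_p([M₁,M₂]), 1 ≤ p ≤ ∞, be nonzero operators defined by (Ax)(t) = ∫_α^β k(t,s)x(s)ds with k(t,s) = a₀ + a₁t + c₁s and (Bx)(t) = b(t)x(t) with b(t) = Σ_{j=0}^n b_j t^j a real polynomial. Let F(z) = δ₁z + δ₂z². If b(t)F₂(k(t,s)) = k(t,s)b(s) holds for almost every (t,s) ∈ [M₁,M₂] × [α,β], where F₂(k(t,s)) = δ₁k(t,s) + δ₂k₁(t,s) and k₁(t,s) = ∫_α^β k(t,τ)k(τ,s)dτ, then b_j = 0 for all j = 1,…,n, i.e., b is a nonzero constant b₀. -/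
open MeasureTheory

/-- The affine kernel `k(t,s) = a₀ + a₁ t + c₁ s`. -/
def kaff (a₀ a₁ c₁ : ℝ) : ℝ → ℝ → ℝ := fun t s => a₀ + a₁ * t + c₁ * s

/-- The first iterated kernel `k₁(t,s) = ∫_α^β k(t,τ) k(τ,s) dτ`. -/
noncomputable def k1aff (a₀ a₁ c₁ α β : ℝ) : ℝ → ℝ → ℝ :=
  fun t s => ∫ τ in α..β, kaff a₀ a₁ c₁ t τ * kaff a₀ a₁ c₁ τ s

open Polynomial in
theorem natDegree_eq_zero_of_linear_mul_eq {l q p : ℝ[X]} (hl : l ≠ 0)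
    (hq : q.natDegree ≤ l.natDegree) (h : q = l * p) : p.natDegree = 0 := by
  rcases eq_or_ne p 0 with rfl | hp
  · simp
  · rw [h, natDegree_mul hl hp] at hq
    lia

open Polynomial in
theorem natDegree_C_mul_mul_X_add_C_le (c d e f : ℝ) :
    (C (c * d) * X + C f).natDegree ≤ (C c * X + C e).natDegree := by
  by_cases hc : c = 0
  · simp [hc]
  · rw [natDegree_linear hc]
    exact natDegree_linear_le

theorem infinite_setOf_of_ae_restrict_Icc {α β : ℝ} (hαβ : α < β) {P : ℝ → Prop}
    (h : ∀ᵐ s ∂(volume : Measure ℝ).restrict (Set.Icc α β), P s) : {s | P s}.Infinite := by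
  intro hfin
  have hcompl : ∀ᵐ s ∂(volume : Measure ℝ).restrict (Set.Icc α β), s ∉ {s | P s} :=
    ae_restrict_of_ae (hfin.countable.ae_notMem volume)
  have hfalse : ∀ᵐ _s ∂(volume : Measure ℝ).restrict (Set.Icc α β), False := by
    filter_upwards [h, hcompl] with s hs hs' using hs' hs
  rw [Filter.eventually_false_iff_eq_bot, ae_eq_bot, Measure.restrict_eq_zero, Real.volume_Icc,
    ENNReal.ofReal_eq_zero] at hfalse
  linarith

theorem k1aff_eq_linear (a₀ a₁ c₁ α β t s : ℝ) :
    k1aff a₀ a₁ c₁ α β t s =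
      k1aff a₀ a₁ c₁ α β t 0 + c₁ * (∫ τ in α..β, kaff a₀ a₁ c₁ t τ) * s := by
  have hint : ∀ f : ℝ → ℝ, Continuous f → IntervalIntegrable f volume α β :=
    fun f hf => hf.intervalIntegrable α β
  unfold k1aff kaff
  rw [mul_right_comm, ← intervalIntegral.integral_const_mul,
    ← intervalIntegral.integral_add (hint _ (by fun_prop)) (hint _ (by fun_prop))]
  congr 1 with τ
  ring

/-- If the nonzero affine kernel `k(t,s) = a₀ + a₁ t + c₁ s` and the nonzero polynomial
`b(t) = ∑_{j=0}^n b_j t^j` satisfy `b(t) F₂(k(t,s)) = k(t,s) b(s)` a.e. on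
`[M₁,M₂] × [α,β]`, where `F₂(k(t,s)) = δ₁ k(t,s) + δ₂ k₁(t,s)`, then `b_j = 0` for
`j = 1,…,n`, i.e. `b` is the nonzero constant `b₀`. -/
theorem poly_mult_must_be_constant (M₁ M₂ α β : ℝ) (hM : M₁ < M₂) (hαβ : α < β)
    (hsub : Set.Icc α β ⊆ Set.Icc M₁ M₂)
    (a₀ a₁ c₁ : ℝ) (hAne : ¬(a₀ = 0 ∧ a₁ = 0 ∧ c₁ = 0))
    (n : ℕ) (bc : ℕ → ℝ) (hBne : ∃ j ≤ n, bc j ≠ 0) (δ₁ δ₂ : ℝ)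
    (h : ∀ᵐ q ∂((volume : Measure (ℝ × ℝ)).restrict (Set.Icc M₁ M₂ ×ˢ Set.Icc α β)),
        (∑ j ∈ Finset.range (n + 1), bc j * q.1 ^ j) *
            (δ₁ * kaff a₀ a₁ c₁ q.1 q.2 + δ₂ * k1aff a₀ a₁ c₁ α β q.1 q.2)
          = kaff a₀ a₁ c₁ q.1 q.2 * (∑ j ∈ Finset.range (n + 1), bc j * q.2 ^ j)) :
    (∀ j, 1 ≤ j → j ≤ n → bc j = 0) ∧ bc 0 ≠ 0 := by
  rw [Measure.volume_eq_prod, ← Measure.prod_restrict] at h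
  have hne : ∀ᵐ t ∂(volume : Measure ℝ).restrict (Set.Icc M₁ M₂), t ≠ -a₀ / a₁ :=
    ae_restrict_of_ae (Measure.ae_ne volume _)
  obtain ⟨t, ht, htne⟩ := (infinite_setOf_of_ae_restrict_Icc hM
    ((Measure.ae_ae_of_ae_prod h).and hne)).nonempty
  set p : Polynomial ℝ := ∑ j ∈ Finset.range (n + 1), Polynomial.C (bc j) * Polynomial.X ^ j
    with hp
  set b : ℝ := ∑ j ∈ Finset.range (n + 1), bc j * t ^ j
  set d : ℝ := b * (δ₁ + δ₂ * ∫ τ in α..β, kaff a₀ a₁ c₁ t τ)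
  set f : ℝ := b * (δ₁ * (a₀ + a₁ * t) + δ₂ * k1aff a₀ a₁ c₁ α β t 0)
  have hpoly : Polynomial.C (c₁ * d) * Polynomial.X + Polynomial.C f =
      (Polynomial.C c₁ * Polynomial.X + Polynomial.C (a₀ + a₁ * t)) * p := by
    refine Polynomial.eq_of_infinite_eval_eq _ _
      ((infinite_setOf_of_ae_restrict_Icc hαβ ht).mono fun s hs => ?_)
    simp only [Set.mem_ofPred_eq, k1aff_eq_linear a₀ a₁ c₁ α β t s] at hs
    have hps : p.eval s = ∑ j ∈ Finset.range (n + 1), bc j * s ^ j := by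
      simp [hp, Polynomial.eval_finsetSum]
    rw [← hps] at hs
    have hk : kaff a₀ a₁ c₁ t s = a₀ + a₁ * t + c₁ * s := rfl
    rw [hk] at hs
    simp only [Set.mem_ofPred_eq, Polynomial.eval_add, Polynomial.eval_mul, Polynomial.eval_C,
      Polynomial.eval_X]
    linear_combination hs
  have hl : Polynomial.C c₁ * Polynomial.X + Polynomial.C (a₀ + a₁ * t) ≠ 0 := by
    intro h0
    have hc : c₁ = 0 := by simpa using congrArg (Polynomial.coeff · 1) h0
    have he : a₀ + a₁ * t = 0 := by simpa using congrArg (Polynomial.coeff · 0) h0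
    by_cases ha : a₁ = 0
    · exact hAne ⟨by simpa [ha] using he, ha, hc⟩
    · exact htne (by rw [eq_div_iff ha]; linarith)
  have hdeg : p.natDegree = 0 := natDegree_eq_zero_of_linear_mul_eq hl
    (natDegree_C_mul_mul_X_add_C_le c₁ d _ f) hpoly
  have hcoeff : ∀ j ≤ n, p.coeff j = bc j := by
    intro j hj
    simp [hp, Polynomial.coeff_X_pow, Nat.lt_succ_of_le hj]
  have hzero : ∀ j, 1 ≤ j → j ≤ n → bc j = 0 := fun j h1 hj => by
    rw [← hcoeff j hj]
    exact Polynomial.coeff_eq_zero_of_natDegree_lt (by lia)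
  refine ⟨hzero, fun h0 => ?_⟩
  obtain ⟨j, hj, hbj⟩ := hBne
  rcases Nat.eq_zero_or_pos j with rfl | hpos
  · exact hbj h0
  · exact hbj (hzero j hpos hj)
end

section
/- Let k(t,s) = a₀ + a₁t + c₁s on [M₁,M₂] × [α,β] with α < β, let k₁(t,s) = ∫_α^β k(t,τ)k(τ,s)dτ, and suppose δ₂ ≠ 0, δ₁ = 1, a₁ ≠ 0 and c₁ = 0. Then δ₁k(t,s) + δ₂k₁(t,s) = k(t,s) holds for almost every (t,s) ∈ [M₁,M₂] × [α,β] if and only if a₀ = −((β+α)/2)·a₁. -/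
open MeasureTheory

lemma k1aff_of_snd_coeff_eq_zero (a₀ a₁ α β t s : ℝ) :
    k1aff a₀ a₁ 0 α β t s
      = (a₀ + a₁ * t) * ((β - α) * (a₀ + (β + α) / 2 * a₁)) := by
  have h : ∫ τ in α..β, (a₀ + a₁ * τ) = a₀ * (β - α) + a₁ * ((β ^ 2 - α ^ 2) / 2) := by
    rw [intervalIntegral.integral_add (Continuous.intervalIntegrable (by fun_prop) _ _)
      (Continuous.intervalIntegrable (by fun_prop) _ _)]
    rw [intervalIntegral.integral_const_mul, integral_id, intervalIntegral.integral_const,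
      smul_eq_mul, mul_comm a₀]
  simp only [k1aff, kaff, zero_mul, add_zero, intervalIntegral.integral_const_mul, h]
  ring

lemma ae_fst_ne (c : ℝ) : ∀ᵐ q ∂(volume : Measure (ℝ × ℝ)), q.1 ≠ c :=
  Measure.quasiMeasurePreserving_fst.ae (Measure.ae_ne volume c)

lemma restrict_Icc_prod_Icc_ne_zero {M₁ M₂ α β : ℝ} (hM : M₁ < M₂) (hαβ : α < β) :
    (volume : Measure (ℝ × ℝ)).restrict (Set.Icc M₁ M₂ ×ˢ Set.Icc α β) ≠ 0 := by
  rw [Ne, Measure.restrict_eq_zero, Measure.volume_eq_prod, Measure.prod_prod]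
  simp [hM, hαβ]

/-- Case δ₂ ≠ 0, δ₁ = 1, a₁ ≠ 0, c₁ = 0: `δ₁ k + δ₂ k₁ = k` a.e. on `[M₁,M₂] × [α,β]`
iff `a₀ = -((β+α)/2) a₁`. -/
theorem kernel_fixed_point_case_a1 (M₁ M₂ α β : ℝ) (hM : M₁ < M₂) (hαβ : α < β)
    (hsub : Set.Icc α β ⊆ Set.Icc M₁ M₂)
    (a₀ a₁ c₁ δ₁ δ₂ : ℝ) (hδ₂ : δ₂ ≠ 0) (hδ₁ : δ₁ = 1) (ha₁ : a₁ ≠ 0) (hc₁ : c₁ = 0) :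
    (∀ᵐ q ∂((volume : Measure (ℝ × ℝ)).restrict (Set.Icc M₁ M₂ ×ˢ Set.Icc α β)),
        δ₁ * kaff a₀ a₁ c₁ q.1 q.2 + δ₂ * k1aff a₀ a₁ c₁ α β q.1 q.2
          = kaff a₀ a₁ c₁ q.1 q.2) ↔ a₀ = -((β + α) / 2) * a₁ := by
  subst hδ₁ hc₁
  simp only [k1aff_of_snd_coeff_eq_zero, kaff]
  constructor
  · intro h
    by_contra hne
    have hfac : a₀ + (β + α) / 2 * a₁ ≠ 0 := fun h0 => hne (by linarith)
    have hroot := ae_restrict_of_ae (s := Set.Icc M₁ M₂ ×ˢ Set.Icc α β) (ae_fst_ne (-a₀ / a₁))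
    have hfalse : ∀ᵐ _ ∂((volume : Measure (ℝ × ℝ)).restrict (Set.Icc M₁ M₂ ×ˢ Set.Icc α β)),
        False := by
      filter_upwards [h, hroot] with q hq hq'
      have hz : δ₂ * ((a₀ + a₁ * q.1) * ((β - α) * (a₀ + (β + α) / 2 * a₁))) = 0 := by
        linarith
      simp only [mul_eq_zero, hδ₂, hfac, sub_ne_zero.mpr hαβ.ne', or_false, false_or] at hz
      exact hq' (by rw [eq_div_iff ha₁]; linarith)
    rw [Filter.eventually_false_iff_eq_bot, ae_eq_bot] at hfalse
    exact restrict_Icc_prod_Icc_ne_zero hM hαβ hfalse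
  · rintro rfl
    refine Filter.Eventually.of_forall fun q => ?_
    ring
end

section
/- Let k(t,s) = a₀ + a₁t + c₁s on [M₁,M₂] × [α,β] with α < β, let k₁(t,s) = ∫_α^β k(t,τ)k(τ,s)dτ, and suppose δ₂ ≠ 0, δ₁ = 1, a₁ = 0 and c₁ ≠ 0. Then δ₁k(t,s) + δ₂k₁(t,s) = k(t,s) holds for almost every (t,s) ∈ [M₁,M₂] × [α,β] if and only if a₀ = −((β+α)/2)·c₁. -/
open MeasureTheory

/-- For `a₁ = 0` the first iterated kernel is a multiple of the kernel itself. -/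
theorem k1aff_zero (a₀ c₁ α β t s : ℝ) :
    k1aff a₀ 0 c₁ α β t s =
      (β - α) * (a₀ + (β + α) / 2 * c₁) * kaff a₀ 0 c₁ t s := by
  simp only [k1aff, kaff, zero_mul, add_zero]
  rw [intervalIntegral.integral_mul_const, intervalIntegral.integral_add
    (by simp) (Continuous.intervalIntegrable (by fun_prop) _ _),
    intervalIntegral.integral_const, intervalIntegral.integral_const_mul, integral_id,
    smul_eq_mul]
  ring

/-- Almost every point of the plane avoids a given horizontal line. -/
theorem ae_snd_ne (c : ℝ) : ∀ᵐ q : ℝ × ℝ, q.2 ≠ c := by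
  have h : ∀ᵐ y : ℝ, y ≠ c := by simp [ae_iff]
  exact Measure.quasiMeasurePreserving_snd.ae h

/-- Case δ₂ ≠ 0, δ₁ = 1, a₁ = 0, c₁ ≠ 0: `δ₁ k + δ₂ k₁ = k` a.e. on `[M₁,M₂] × [α,β]`
iff `a₀ = -((β+α)/2) c₁`. -/
theorem kernel_fixed_point_case_c1 (M₁ M₂ α β : ℝ) (hM : M₁ < M₂) (hαβ : α < β)
    (hsub : Set.Icc α β ⊆ Set.Icc M₁ M₂)
    (a₀ a₁ c₁ δ₁ δ₂ : ℝ) (hδ₂ : δ₂ ≠ 0) (hδ₁ : δ₁ = 1) (ha₁ : a₁ = 0) (hc₁ : c₁ ≠ 0) :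
    (∀ᵐ q ∂((volume : Measure (ℝ × ℝ)).restrict (Set.Icc M₁ M₂ ×ˢ Set.Icc α β)),
        δ₁ * kaff a₀ a₁ c₁ q.1 q.2 + δ₂ * k1aff a₀ a₁ c₁ α β q.1 q.2
          = kaff a₀ a₁ c₁ q.1 q.2) ↔ a₀ = -((β + α) / 2) * c₁ := by
  subst hδ₁ ha₁
  simp only [k1aff_zero, one_mul, add_eq_left, mul_eq_zero, hδ₂, false_or, (sub_pos.2 hαβ).ne']
  constructor
  · intro h
    have : (ae ((volume : Measure (ℝ × ℝ)).restrict (Set.Icc M₁ M₂ ×ˢ Set.Icc α β))).NeBot := by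
      rw [ae_restrict_neBot, Measure.volume_eq_prod, Measure.prod_prod]
      simp [hM, hαβ]
    obtain ⟨q, hq, hne⟩ := (h.and (ae_restrict_of_ae (ae_snd_ne (-a₀ / c₁)))).exists
    rcases hq with hq | hq
    · linarith
    · refine absurd ?_ hne
      rw [eq_div_iff hc₁]
      simp only [kaff] at hq
      linarith
  · intro h
    refine Filter.Eventually.of_forall fun q => Or.inl ?_
    rw [h]
    ring
end

section
/- Let k(t,s) = a₀ + a₁t + c₁s on [M₁,M₂] × [α,β] with α < β, let k₁(t,s) = ∫_α^β k(t,τ)k(τ,s)dτ, and suppose δ₂ ≠ 0, δ₁ ≠ 1, a₁ = 0 and c₁ ≠ 0. Then δ₁k(t,s) + δ₂k₁(t,s) = k(t,s) holds for almost every (t,s) ∈ [M₁,M₂] × [α,β] if and only if a₀ = (2 − 2δ₁ − δ₂(β² − α²)c₁) / (2δ₂(β − α)). -/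
open MeasureTheory

theorem k1aff_of_snd_affine (a₀ c₁ α β t s : ℝ) :
    k1aff a₀ 0 c₁ α β t s
      = (a₀ * (β - α) + c₁ * ((β ^ 2 - α ^ 2) / 2)) * kaff a₀ 0 c₁ t s := by
  simp only [k1aff, kaff, zero_mul, add_zero]
  rw [intervalIntegral.integral_mul_const,
    intervalIntegral.integral_add (by simp) (Continuous.intervalIntegrable (by fun_prop) _ _),
    intervalIntegral.integral_const_mul, integral_id, intervalIntegral.integral_const,
    smul_eq_mul, mul_comm (β - α) a₀]

theorem volume_restrict_rectangle_ne_zero {a b c d : ℝ} (hab : a < b) (hcd : c < d) :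
    (volume : Measure (ℝ × ℝ)).restrict (Set.Icc a b ×ˢ Set.Icc c d) ≠ 0 := by
  rw [Ne, Measure.restrict_eq_zero, Measure.volume_eq_prod, Measure.prod_prod]
  simp [hab, hcd]

/-- Case δ₂ ≠ 0, δ₁ ≠ 1, a₁ = 0, c₁ ≠ 0: `δ₁ k + δ₂ k₁ = k` a.e. on `[M₁,M₂] × [α,β]`
iff `a₀ = (2 - 2δ₁ - δ₂(β² - α²)c₁)/(2δ₂(β - α))`. -/
theorem kernel_fixed_point_case_c1_delta1_ne_one (M₁ M₂ α β : ℝ) (hM : M₁ < M₂) (hαβ : α < β)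
    (hsub : Set.Icc α β ⊆ Set.Icc M₁ M₂)
    (a₀ a₁ c₁ δ₁ δ₂ : ℝ) (hδ₂ : δ₂ ≠ 0) (hδ₁ : δ₁ ≠ 1) (ha₁ : a₁ = 0) (hc₁ : c₁ ≠ 0) :
    (∀ᵐ q ∂((volume : Measure (ℝ × ℝ)).restrict (Set.Icc M₁ M₂ ×ˢ Set.Icc α β)),
        δ₁ * kaff a₀ a₁ c₁ q.1 q.2 + δ₂ * k1aff a₀ a₁ c₁ α β q.1 q.2
          = kaff a₀ a₁ c₁ q.1 q.2) ↔
      a₀ = (2 - 2 * δ₁ - δ₂ * (β ^ 2 - α ^ 2) * c₁) / (2 * δ₂ * (β - α)) := by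
  subst ha₁
  have hβα : β - α ≠ 0 := (sub_pos.2 hαβ).ne'
  have hfactor : a₀ = (2 - 2 * δ₁ - δ₂ * (β ^ 2 - α ^ 2) * c₁) / (2 * δ₂ * (β - α)) ↔
      δ₁ + δ₂ * (a₀ * (β - α) + c₁ * ((β ^ 2 - α ^ 2) / 2)) = 1 := by
    rw [eq_div_iff (by positivity)]
    constructor <;> intro h <;> linarith
  rw [hfactor]
  simp only [k1aff_of_snd_affine]
  constructor
  · intro h
    have : (ae ((volume : Measure (ℝ × ℝ)).restrict
        (Set.Icc M₁ M₂ ×ˢ Set.Icc α β))).NeBot :=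
      ae_neBot.2 (volume_restrict_rectangle_ne_zero hM hαβ)
    obtain ⟨q, hq, hne⟩ := (h.and (ae_restrict_of_ae (ae_snd_ne (-a₀ / c₁)))).exists
    have hk : kaff a₀ 0 c₁ q.1 q.2 ≠ 0 := by
      intro h0
      apply hne
      rw [eq_div_iff hc₁]
      simp only [kaff] at h0
      linarith
    exact mul_right_cancel₀ hk (by linarith)
  · intro h
    refine Filter.Eventually.of_forall fun q => ?_
    linear_combination kaff a₀ 0 c₁ q.1 q.2 * h
end

section
/- Let M₁ < M₂ with 0 ∉ [M₁,M₂], let [α,β] ⊆ [M₁,M₂] with α < β, let k(t,s) = a₀ + a₁t + c₁s, let b(t) = Σ_{j=1}^n b_j t^{−j} be a Laurent polynomial with only negative powers and b_n ≠ 0 (n a positive integer), and let F₂(k(t,s)) = δ₁k(t,s) + δ₂k₁(t,s) where k₁(t,s) = ∫_α^β k(t,τ)k(τ,s)dτ. If k(t,s)b(s) = b(t)F₂(k(t,s)) for almost every (t,s) ∈ [M₁,M₂] × [α,β], then a₀ = a₁ = c₁ = 0, i.e., k ≡ 0 and the integral operator A with kernel k is zero. -/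
open MeasureTheory

/-- The iterated kernel of an affine kernel is a polynomial of degree at most one in each variable. -/
theorem k1aff_eq (a₀ a₁ c₁ α β t s : ℝ) :
    k1aff a₀ a₁ c₁ α β t s =
      (a₀ ^ 2 * (β - α) + (β ^ 2 - α ^ 2) / 2 * (a₀ * (a₁ + c₁)) + a₁ * c₁ * (β ^ 3 - α ^ 3) / 3)
      + (a₁ ^ 2 * (β ^ 2 - α ^ 2) / 2 + a₁ * a₀ * (β - α)) * t
      + (a₀ * c₁ * (β - α) + c₁ ^ 2 * (β ^ 2 - α ^ 2) / 2) * s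
      + a₁ * c₁ * (β - α) * (t * s) := by
  have hpoly : ∀ τ, kaff a₀ a₁ c₁ t τ * kaff a₀ a₁ c₁ τ s =
      (a₀ + a₁ * t) * (a₀ + c₁ * s) + ((a₀ + a₁ * t) * a₁ + c₁ * (a₀ + c₁ * s)) * τ
        + c₁ * a₁ * τ ^ 2 := by
    intro τ
    simp only [kaff]
    ring
  simp only [k1aff, hpoly]
  rw [intervalIntegral.integral_add (by apply Continuous.intervalIntegrable; fun_prop)
      (by apply Continuous.intervalIntegrable; fun_prop),
    intervalIntegral.integral_add (by apply Continuous.intervalIntegrable; fun_prop)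
      (by apply Continuous.intervalIntegrable; fun_prop),
    intervalIntegral.integral_const, intervalIntegral.integral_const_mul,
    intervalIntegral.integral_const_mul, integral_id, integral_pow]
  simp only [smul_eq_mul]
  norm_num
  ring

/-- Clearing denominators in a Laurent polynomial with only negative powers. -/
theorem pow_mul_sum_zpow_neg (n : ℕ) (bc : ℕ → ℝ) {t : ℝ} (ht : t ≠ 0) :
    t ^ n * ∑ j ∈ Finset.Icc 1 n, bc j * t ^ (-(j : ℤ)) =
      ∑ j ∈ Finset.Icc 1 n, bc j * t ^ (n - j) := by
  rw [Finset.mul_sum]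
  refine Finset.sum_congr rfl fun j hj => ?_
  rw [zpow_neg, zpow_natCast, pow_sub₀ t ht (Finset.mem_Icc.mp hj).2]
  ring

theorem sum_mul_zero_pow_sub {n : ℕ} (hn : 1 ≤ n) (bc : ℕ → ℝ) :
    ∑ j ∈ Finset.Icc 1 n, bc j * (0 : ℝ) ^ (n - j) = bc n := by
  rw [Finset.sum_eq_single_of_mem n (Finset.mem_Icc.mpr ⟨hn, le_rfl⟩)]
  · simp
  · intro j hj hjn
    have := (Finset.mem_Icc.mp hj).2
    rw [zero_pow (by omega), mul_zero]

/-- A real-analytic function on the plane that vanishes almost everywhere on a nondegenerate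
rectangle vanishes identically. -/
theorem eq_zero_of_ae_restrict_rectangle {G : ℝ × ℝ → ℝ} (hG : AnalyticOnNhd ℝ G Set.univ)
    {a b c d : ℝ} (hab : a < b) (hcd : c < d)
    (h : ∀ᵐ q ∂((volume : Measure (ℝ × ℝ)).restrict (Set.Icc a b ×ˢ Set.Icc c d)), G q = 0) :
    G = 0 := by
  have hopen : IsOpen (Set.Ioo a b ×ˢ Set.Ioo c d) := isOpen_Ioo.prod isOpen_Ioo
  have hae : G =ᵐ[(volume : Measure (ℝ × ℝ)).restrict (Set.Ioo a b ×ˢ Set.Ioo c d)]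
      (0 : ℝ × ℝ → ℝ) :=
    ae_restrict_of_ae_restrict_of_subset
      (Set.prod_mono Set.Ioo_subset_Icc_self Set.Ioo_subset_Icc_self) h
  have hon := Measure.eqOn_open_of_ae_eq hae hopen
    (hG.continuousOn.mono (Set.subset_univ _)) continuousOn_const
  obtain ⟨x, hx⟩ := exists_between hab
  obtain ⟨y, hy⟩ := exists_between hcd
  exact hG.eq_of_eventuallyEq (fun _ _ => analyticAt_const)
    (hon.eventuallyEq_of_mem (hopen.mem_nhds (Set.mk_mem_prod hx hy)))

/-- If `0 ∉ [M₁,M₂]` and `b(t) = ∑_{j=1}^n b_j t^{-j}` is a Laurent polynomial with only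
negative powers and `b_n ≠ 0`, then `k(t,s) b(s) = b(t) F₂(k(t,s))` a.e. on
`[M₁,M₂] × [α,β]` forces `a₀ = a₁ = c₁ = 0`, i.e. the kernel is identically zero. -/
theorem laurent_mult_forces_zero_kernel (M₁ M₂ α β : ℝ) (hM : M₁ < M₂)
    (h0 : (0 : ℝ) ∉ Set.Icc M₁ M₂) (hαβ : α < β) (hsub : Set.Icc α β ⊆ Set.Icc M₁ M₂)
    (a₀ a₁ c₁ δ₁ δ₂ : ℝ) (n : ℕ) (hn : 1 ≤ n) (bc : ℕ → ℝ) (hbn : bc n ≠ 0)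
    (h : ∀ᵐ q ∂((volume : Measure (ℝ × ℝ)).restrict (Set.Icc M₁ M₂ ×ˢ Set.Icc α β)),
        kaff a₀ a₁ c₁ q.1 q.2 * (∑ j ∈ Finset.Icc 1 n, bc j * q.2 ^ (-(j : ℤ)))
          = (∑ j ∈ Finset.Icc 1 n, bc j * q.1 ^ (-(j : ℤ))) *
              (δ₁ * kaff a₀ a₁ c₁ q.1 q.2 + δ₂ * k1aff a₀ a₁ c₁ α β q.1 q.2)) :
    a₀ = 0 ∧ a₁ = 0 ∧ c₁ = 0 := by
  set B : ℝ → ℝ := fun t => ∑ j ∈ Finset.Icc 1 n, bc j * t ^ (n - j) with hB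
  have hB0 : B 0 = bc n := sum_mul_zero_pow_sub hn bc
  have hG : (fun q : ℝ × ℝ => kaff a₀ a₁ c₁ q.1 q.2 * q.1 ^ n * B q.2 - q.2 ^ n * B q.1 *
      (δ₁ * kaff a₀ a₁ c₁ q.1 q.2 + δ₂ * k1aff a₀ a₁ c₁ α β q.1 q.2)) = 0 := by
    refine eq_zero_of_ae_restrict_rectangle ?_ hM hαβ ?_
    · intro q _
      have hfst : AnalyticAt ℝ (fun r : ℝ × ℝ => r.1) q := analyticAt_fst
      have hsnd : AnalyticAt ℝ (fun r : ℝ × ℝ => r.2) q := analyticAt_snd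
      have hBfst : AnalyticAt ℝ (fun r : ℝ × ℝ => B r.1) q :=
        Finset.analyticAt_fun_sum _ fun j _ => analyticAt_const.mul (hfst.pow _)
      have hBsnd : AnalyticAt ℝ (fun r : ℝ × ℝ => B r.2) q :=
        Finset.analyticAt_fun_sum _ fun j _ => analyticAt_const.mul (hsnd.pow _)
      have hk : AnalyticAt ℝ (fun r : ℝ × ℝ => kaff a₀ a₁ c₁ r.1 r.2) q :=
        (analyticAt_const.add (analyticAt_const.mul hfst)).add (analyticAt_const.mul hsnd)
      have hk1 : AnalyticAt ℝ (fun r : ℝ × ℝ => k1aff a₀ a₁ c₁ α β r.1 r.2) q := by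
        simp only [k1aff_eq]
        exact ((analyticAt_const.add (analyticAt_const.mul hfst)).add
          (analyticAt_const.mul hsnd)).add (analyticAt_const.mul (hfst.mul hsnd))
      exact ((hk.mul (hfst.pow n)).mul hBsnd).sub (((hsnd.pow n).mul hBfst).mul
        ((analyticAt_const.mul hk).add (analyticAt_const.mul hk1)))
    · filter_upwards [h, ae_restrict_mem (measurableSet_Icc.prod measurableSet_Icc)] with q hq hmem
      have ht : q.1 ≠ 0 := fun h' => h0 (h' ▸ hmem.1)
      have hs : q.2 ≠ 0 := fun h' => h0 (h' ▸ hsub hmem.2)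
      simp only [hB]
      rw [← pow_mul_sum_zpow_neg n bc ht, ← pow_mul_sum_zpow_neg n bc hs]
      linear_combination q.1 ^ n * q.2 ^ n * hq
  have key : ∀ t s, kaff a₀ a₁ c₁ t s * t ^ n * B s - s ^ n * B t *
      (δ₁ * kaff a₀ a₁ c₁ t s + δ₂ * k1aff a₀ a₁ c₁ α β t s) = 0 :=
    fun t s => congrFun hG (t, s)
  have hn0 : n ≠ 0 := by omega
  have hline : ∀ t : ℝ, t ≠ 0 → a₀ + a₁ * t = 0 := by
    intro t ht
    simpa [kaff, hB0, hn0, ht, hbn] using key t 0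
  have ha₁ : a₁ = 0 := by linarith [hline 1 one_ne_zero, hline 2 two_ne_zero]
  have ha₀ : a₀ = 0 := by linarith [hline 1 one_ne_zero]
  refine ⟨ha₀, ha₁, ?_⟩
  subst ha₁ ha₀
  have hp : δ₁ * c₁ + δ₂ * (c₁ ^ 2 * (β ^ 2 - α ^ 2) / 2) = 0 := by
    simpa [kaff, k1aff_eq, hB0, hn0, hbn] using key 0 1
  have hzero : ∀ s : ℝ, s ≠ 0 → c₁ * B s = 0 := by
    intro s hs
    have h1 := key 1 s
    simp only [kaff, k1aff_eq] at h1
    refine mul_left_cancel₀ hs ?_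
    linear_combination h1 + s ^ n * B 1 * s * hp
  have hcont : Continuous fun s => c₁ * B s := by
    simp only [hB]
    fun_prop
  have hall := hcont.ext_on (dense_compl_singleton (0 : ℝ)) continuous_const
    (fun s hs => hzero s hs)
  have hc : c₁ * B 0 = 0 := congrFun hall 0
  rw [hB0] at hc
  exact (mul_eq_zero.mp hc).resolve_right hbn
end
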